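/- arXiv:1611.01125 — 2 statements merged into one kernel-verified Lean document; each statement's English description precedes it below -/
import Mathlib

section
/- Property of α-divergences (Lemma 3.1, convex case): Suppose the family of densities {p_θ : θ ∈ Θ} is convex, i.e., for any θ, θ' ∈ Θ and ω ∈ (0,1) there exists θ̄ ∈ Θ with p_{θ̄} = ω·p_θ + (1−ω)·p_{θ'} μ-a.e. Let θ* ∈ Θ satisfy D(p_{θ0}, p_{θ*}) ≤ D(p_{θ0}, p_θ) < ∞ for all θ ∈ Θ. Then for every α ∈ (0,1) and every θ ∈ Θ, 0 < A_{θ0,α}(θ, θ*) ≤ 1; consequently D_{θ0,α}(θ, θ*) ≥ 0 for all θ ∈ Θ and D_{θ0,α}(θ*, θ*) = 0. -/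
open MeasureTheory Filter Set
open scoped ENNReal NNReal

noncomputable section

/-- The α-affinity `A_{θ0,α}(θ, θ') = ∫ (p_θ/p_{θ'})^α p_{θ0} dμ`. -/
def alphaAff {X Θ : Type*} [MeasurableSpace X]
    (μ : Measure X) (p : Θ → X → ℝ) (p0 : X → ℝ) (α : ℝ) (θ θ' : Θ) : ℝ :=
  ∫ x, (p θ x / p θ' x) ^ α * p0 x ∂μ

/-- The α-divergence `D_{θ0,α}(θ, θ') = (α-1)⁻¹ log A_{θ0,α}(θ, θ')`. -/
def alphaDiv {X Θ : Type*} [MeasurableSpace X]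
    (μ : Measure X) (p : Θ → X → ℝ) (p0 : X → ℝ) (α : ℝ) (θ θ' : Θ) : ℝ :=
  (α - 1)⁻¹ * Real.log (alphaAff μ p p0 α θ θ')

/-- The KL divergence `D(p0, q) = ∫ p0 log(p0/q) dμ`. -/
def klDivFn {X : Type*} [MeasurableSpace X] (μ : Measure X) (p0 q : X → ℝ) : ℝ :=
  ∫ x, p0 x * Real.log (p0 x / q x) ∂μ

/-- Fatou's lemma for the Bochner integral, with a uniform bound on the integrals. -/
lemma integrable_and_integral_le_of_tendsto_ae {X : Type*} [MeasurableSpace X] {μ : Measure X}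
    {F : ℕ → X → ℝ} {f : X → ℝ} {C : ℝ}
    (hF_nonneg : ∀ n, 0 ≤ᵐ[μ] F n) (hF_int : ∀ n, Integrable (F n) μ)
    (hF_le : ∀ n, ∫ x, F n x ∂μ ≤ C)
    (hlim : ∀ᵐ x ∂μ, Tendsto (fun n => F n x) atTop (nhds (f x))) :
    Integrable f μ ∧ ∫ x, f x ∂μ ≤ C := by
  have hC : 0 ≤ C := (integral_nonneg_of_ae (hF_nonneg 0)).trans (hF_le 0)
  have hf_meas : AEStronglyMeasurable f μ :=
    aestronglyMeasurable_of_tendsto_ae atTop (fun n => (hF_int n).aestronglyMeasurable) hlim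
  have hf_nonneg : 0 ≤ᵐ[μ] f := by
    filter_upwards [hlim, ae_all_iff.2 hF_nonneg] with x hx h0
    exact ge_of_tendsto' hx h0
  have hfatou : ∫⁻ x, ENNReal.ofReal (f x) ∂μ ≤ ENNReal.ofReal C := calc
    ∫⁻ x, ENNReal.ofReal (f x) ∂μ
        = ∫⁻ x, liminf (fun n => ENNReal.ofReal (F n x)) atTop ∂μ := by
      refine lintegral_congr_ae ?_
      filter_upwards [hlim] with x hx
      exact ((ENNReal.continuous_ofReal.tendsto _).comp hx).liminf_eq.symm
    _ ≤ liminf (fun n => ∫⁻ x, ENNReal.ofReal (F n x) ∂μ) atTop :=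
      lintegral_liminf_le' fun n => (hF_int n).aemeasurable.ennreal_ofReal
    _ ≤ ENNReal.ofReal C := by
      refine liminf_le_of_le (by isBoundedDefault) fun b hb => ?_
      obtain ⟨n, hn⟩ := hb.exists
      rw [← ofReal_integral_eq_lintegral_ofReal (hF_int n) (hF_nonneg n)] at hn
      exact hn.trans (ENNReal.ofReal_le_ofReal (hF_le n))
  have hf_int : Integrable f μ := by
    refine ⟨hf_meas, ?_⟩
    rw [hasFiniteIntegral_iff_ofReal hf_nonneg]
    exact hfatou.trans_lt ENNReal.ofReal_lt_top
  refine ⟨hf_int, ?_⟩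
  rw [← ofReal_integral_eq_lintegral_ofReal hf_int hf_nonneg] at hfatou
  exact (ENNReal.ofReal_le_ofReal_iff hC).1 hfatou

/-- Concavity of the logarithm between `1` and `r`. -/
lemma mul_log_le_log_one_add_mul {r ω : ℝ} (hr : 0 < r) (hω0 : 0 ≤ ω) (hω1 : ω ≤ 1) :
    ω * Real.log r ≤ Real.log (1 + ω * (r - 1)) := by
  have h := rpow_one_add_le_one_add_mul_self (s := r - 1) (by linarith) hω0 hω1
  rw [add_sub_cancel] at h
  rw [← Real.log_rpow hr]
  exact Real.log_le_log (Real.rpow_pos_of_pos hr ω) h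

/-- If moving from `1` towards `r` never increases the expected logarithm above `0`, then `r` has
expectation at most `1`. -/
lemma integrable_and_integral_le_one_of_integral_log_le {X : Type*} [MeasurableSpace X]
    {P : Measure X} [IsProbabilityMeasure P] {r : X → ℝ} (hr_pos : ∀ᵐ x ∂P, 0 < r x)
    (hlog : Integrable (fun x => Real.log (r x)) P)
    (hmix : ∀ ω : ℝ, 0 < ω → ω < 1 →
      Integrable (fun x => Real.log (1 + ω * (r x - 1))) P ∧
        ∫ x, Real.log (1 + ω * (r x - 1)) ∂P ≤ 0) :
    Integrable r P ∧ ∫ x, r x ∂P ≤ 1 := by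
  have hω0 (n : ℕ) : (0 : ℝ) < ((n : ℝ) + 2)⁻¹ := by positivity
  have hω1 (n : ℕ) : ((n : ℝ) + 2)⁻¹ < 1 := inv_lt_one_of_one_lt₀ (by
    have : (0 : ℝ) ≤ n := n.cast_nonneg
    linarith)
  obtain ⟨hint, hle⟩ := integrable_and_integral_le_of_tendsto_ae (μ := P)
    (F := fun (n : ℕ) x =>
      ((n : ℝ) + 2) * Real.log (1 + ((n : ℝ) + 2)⁻¹ * (r x - 1)) - Real.log (r x))
    (f := fun x => r x - 1 - Real.log (r x)) (C := -∫ x, Real.log (r x) ∂P)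
    (fun n => by
      filter_upwards [hr_pos] with x hx
      have h := mul_log_le_log_one_add_mul hx (hω0 n).le (hω1 n).le
      rw [inv_mul_le_iff₀ (by positivity)] at h
      exact sub_nonneg.2 h)
    (fun n => ((hmix _ (hω0 n) (hω1 n)).1.const_mul _).sub hlog)
    (fun n => by
      have hmixn := hmix _ (hω0 n) (hω1 n)
      rw [integral_sub (hmixn.1.const_mul _) hlog, integral_const_mul]
      have := mul_nonpos_of_nonneg_of_nonpos (a := (n : ℝ) + 2) (by positivity) hmixn.2
      linarith)
    (Eventually.of_forall fun x => by
      refine Tendsto.sub_const ?_ _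
      have h := (Real.tendsto_mul_log_one_add_div_atTop (r x - 1)).comp
        (tendsto_atTop_add_const_right atTop (2 : ℝ) tendsto_natCast_atTop_atTop)
      refine h.congr fun n => ?_
      simp only [Function.comp_apply, div_eq_inv_mul])
  have hsum : (fun x => (r x - 1 - Real.log (r x)) + Real.log (r x) + 1) = r := by
    funext x
    ring
  have hr_int : Integrable r P := by
    rw [← hsum]
    exact (hint.add hlog).add (integrable_const 1)
  refine ⟨hr_int, ?_⟩
  have hsub : Integrable (fun x => r x - 1) P := hr_int.sub (integrable_const 1)
  rw [integral_sub hsub hlog, integral_sub hr_int (integrable_const 1)] at hle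
  simp only [integral_const, probReal_univ, smul_eq_mul, mul_one] at hle
  linarith

/-- A positive function with expectation at most `1` has fractional moments in `(0, 1]`. -/
lemma integral_rpow_pos_and_le_one {X : Type*} [MeasurableSpace X]
    {P : Measure X} [IsProbabilityMeasure P] {r : X → ℝ} (hr_pos : ∀ᵐ x ∂P, 0 < r x)
    (hr_int : Integrable r P) (hr_le : ∫ x, r x ∂P ≤ 1) {α : ℝ} (hα0 : 0 ≤ α) (hα1 : α ≤ 1) :
    0 < ∫ x, r x ^ α ∂P ∧ ∫ x, r x ^ α ∂P ≤ 1 := by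
  have hbound : ∀ᵐ x ∂P, r x ^ α ≤ 1 + α * (r x - 1) := by
    filter_upwards [hr_pos] with x hx
    simpa using rpow_one_add_le_one_add_mul_self (s := r x - 1) (by linarith) hα0 hα1
  have hnonneg : ∀ᵐ x ∂P, 0 ≤ r x ^ α := by
    filter_upwards [hr_pos] with x hx using (Real.rpow_pos_of_pos hx α).le
  have hsub : Integrable (fun x => r x - 1) P := hr_int.sub (integrable_const 1)
  have hlin : Integrable (fun x => 1 + α * (r x - 1)) P :=
    (integrable_const 1).add (hsub.const_mul α)
  have hint : Integrable (fun x => r x ^ α) P := by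
    refine hlin.mono' (hr_int.aemeasurable.pow_const α).aestronglyMeasurable ?_
    filter_upwards [hbound, hnonneg] with x hx h0
    rwa [Real.norm_of_nonneg h0]
  constructor
  · rw [integral_pos_iff_support_of_nonneg_ae hnonneg hint]
    have hsupp : (Function.support fun x => r x ^ α) =ᵐ[P] univ := by
      rw [eventuallyEq_univ]
      filter_upwards [hr_pos] with x hx using (Real.rpow_pos_of_pos hx α).ne'
    rw [measure_congr hsupp, measure_univ]
    exact one_pos
  · calc ∫ x, r x ^ α ∂P ≤ ∫ x, (1 + α * (r x - 1)) ∂P := integral_mono_ae hint hlin hbound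
      _ = 1 + α * (∫ x, r x ∂P - 1) := by
        rw [integral_add (integrable_const 1) (hsub.const_mul α), integral_const_mul,
          integral_sub hr_int (integrable_const 1)]
        simp
      _ ≤ 1 := by nlinarith

/-- Lemma 3.1 (convex case): if the family of densities is convex and θ* minimizes the
KL divergence to the true density, then `0 < A_{θ0,α}(θ, θ*) ≤ 1` for all θ and all
`α ∈ (0,1)`, hence the α-divergence is a nonnegative divergence vanishing at θ*. -/
theorem alpha_divergence_property
    {X Θ : Type*} [MeasurableSpace X]
    (μ : Measure X) [SigmaFinite μ]
    (p : Θ → X → ℝ) (p0 : X → ℝ)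
    (hp_meas : ∀ θ, Measurable (p θ)) (hp0_meas : Measurable p0)
    (hp_nonneg : ∀ θ x, 0 ≤ p θ x) (hp0_nonneg : ∀ x, 0 ≤ p0 x)
    (hp_dens : ∀ θ, ∫ x, p θ x ∂μ = 1) (hp0_dens : ∫ x, p0 x ∂μ = 1)
    (hp_pos : ∀ θ : Θ,
      ∀ᵐ x ∂(μ.withDensity fun x => ENNReal.ofReal (p0 x)), 0 < p θ x)
    (hconvex : ∀ θ θ' : Θ, ∀ ω : ℝ, 0 < ω → ω < 1 →
      ∃ θbar : Θ, ∀ᵐ x ∂μ, p θbar x = ω * p θ x + (1 - ω) * p θ' x)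
    (hKL_int : ∀ θ : Θ, Integrable (fun x => p0 x * Real.log (p0 x / p θ x)) μ)
    (θstar : Θ) (hθstar : ∀ θ : Θ, klDivFn μ p0 (p θstar) ≤ klDivFn μ p0 (p θ))
    (α : ℝ) (hα0 : 0 < α) (hα1 : α < 1) :
    (∀ θ : Θ, 0 < alphaAff μ p p0 α θ θstar ∧ alphaAff μ p p0 α θ θstar ≤ 1) ∧
    (∀ θ : Θ, 0 ≤ alphaDiv μ p p0 α θ θstar) ∧
    alphaDiv μ p p0 α θstar θstar = 0 := by
  set P : Measure X := μ.withDensity fun x => ENNReal.ofReal (p0 x) with hP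
  have hp0_meas' : Measurable fun x => ENNReal.ofReal (p0 x) := hp0_meas.ennreal_ofReal
  have hp0_int : Integrable p0 μ := by
    by_contra h
    simp [integral_undef h] at hp0_dens
  have : IsProbabilityMeasure P := by
    refine ⟨?_⟩
    rw [hP, withDensity_apply _ MeasurableSet.univ, Measure.restrict_univ,
      ← ofReal_integral_eq_lintegral_ofReal hp0_int (Eventually.of_forall hp0_nonneg),
      hp0_dens, ENNReal.ofReal_one]
  have hfin : ∀ᵐ x ∂μ, ENNReal.ofReal (p0 x) < ∞ :=
    Eventually.of_forall fun _ => ENNReal.ofReal_lt_top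
  have hintegral (g : X → ℝ) : ∫ x, g x ∂P = ∫ x, p0 x * g x ∂μ := by
    rw [hP, integral_withDensity_eq_integral_toReal_smul hp0_meas' hfin]
    simp only [ENNReal.toReal_ofReal (hp0_nonneg _), smul_eq_mul]
  have hKL_int_P (θ : Θ) : Integrable (fun x => Real.log (p0 x / p θ x)) P := by
    rw [hP, integrable_withDensity_iff_integrable_smul' hp0_meas' hfin]
    simpa only [ENNReal.toReal_ofReal (hp0_nonneg _), smul_eq_mul] using hKL_int θ
  have hp0_pos : ∀ᵐ x ∂P, 0 < p0 x := by
    rw [hP, ae_withDensity_iff hp0_meas']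
    exact Eventually.of_forall fun x hx => by simpa using hx
  have hlog_ratio (θ : Θ) : (fun x => Real.log (p0 x / p θstar x) - Real.log (p0 x / p θ x))
      =ᵐ[P] fun x => Real.log (p θ x / p θstar x) := by
    filter_upwards [hp0_pos, hp_pos θ, hp_pos θstar] with x h0 h1 h2
    rw [Real.log_div h0.ne' h2.ne', Real.log_div h0.ne' h1.ne', Real.log_div h1.ne' h2.ne']
    ring
  have hlog_int (θ : Θ) : Integrable (fun x => Real.log (p θ x / p θstar x)) P :=
    ((hKL_int_P θstar).sub (hKL_int_P θ)).congr (hlog_ratio θ)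
  have hlog_le (θ : Θ) : ∫ x, Real.log (p θ x / p θstar x) ∂P ≤ 0 := by
    rw [← integral_congr_ae (hlog_ratio θ), integral_sub (hKL_int_P θstar) (hKL_int_P θ),
      hintegral, hintegral]
    exact sub_nonpos.2 (hθstar θ)
  have hratio_pos (θ : Θ) : ∀ᵐ x ∂P, 0 < p θ x / p θstar x := by
    filter_upwards [hp_pos θ, hp_pos θstar] with x h1 h2 using div_pos h1 h2
  have haff (θ : Θ) : alphaAff μ p p0 α θ θstar = ∫ x, (p θ x / p θstar x) ^ α ∂P := by
    rw [hintegral]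
    exact integral_congr_ae (Eventually.of_forall fun x => mul_comm _ _)
  have hmain (θ : Θ) : 0 < alphaAff μ p p0 α θ θstar ∧ alphaAff μ p p0 α θ θstar ≤ 1 := by
    obtain ⟨hr_int, hr_le⟩ := integrable_and_integral_le_one_of_integral_log_le
      (hratio_pos θ) (hlog_int θ) fun ω hω0 hω1 => by
        obtain ⟨θbar, hbar⟩ := hconvex θ θstar ω hω0 hω1
        have hmix : (fun x => Real.log (p θbar x / p θstar x))
            =ᵐ[P] fun x => Real.log (1 + ω * (p θ x / p θstar x - 1)) := by
          filter_upwards [(withDensity_absolutelyContinuous μ _).ae_le hbar,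
            hp_pos θstar] with x hx h2
          rw [hx]
          congr 1
          field_simp
          ring
        exact ⟨(hlog_int θbar).congr hmix, (integral_congr_ae hmix).symm.trans_le (hlog_le θbar)⟩
    rw [haff]
    exact integral_rpow_pos_and_le_one (hratio_pos θ) hr_int hr_le hα0.le hα1.le
  refine ⟨hmain, fun θ => ?_, ?_⟩
  · exact mul_nonneg_of_nonpos_of_nonpos (inv_nonpos.2 (by linarith))
      (Real.log_nonpos (hmain θ).1.le (hmain θ).2)
  · have hone : (fun x => (p θstar x / p θstar x) ^ α) =ᵐ[P] fun _ => (1 : ℝ) := by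
      filter_upwards [hp_pos θstar] with x hx
      rw [div_self hx.ne', Real.one_rpow]
    rw [alphaDiv, haff, integral_congr_ae hone]
    simp
end
end

section
/- Strict positivity of the α-divergence off the optimum: Under the hypotheses of Lemma 3.1 (the family {p_θ : θ ∈ Θ} is convex and θ* ∈ Θ minimizes the KL divergence D(p_{θ0}, p_θ) over Θ, with all these KL divergences finite), for any fixed α ∈ (0,1) and θ ∈ Θ one has D_{θ0,α}(θ, θ*) = 0 if and only if p_θ = p_{θ*} almost everywhere on the support of P_{θ0} (i.e., P_{θ0}-a.e.). -/
open MeasureTheory Filter Set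
open scoped ENNReal NNReal

noncomputable section

theorem neg_two_le_mul_log_one_add_div {t : ℝ} (ht : -1 ≤ t) {a : ℝ} (ha : 2 ≤ a) :
    -2 ≤ a * Real.log (1 + t / a) := by
  have ha0 : 0 < a := by linarith
  have hat : 0 < a + t := by linarith
  have heq : 1 + t / a = (a + t) / a := by field_simp
  have hlog := Real.one_sub_inv_le_log_of_pos (div_pos hat ha0)
  rw [heq]
  refine le_trans ?_ (mul_le_mul_of_nonneg_left hlog ha0.le)
  rw [inv_div, show a * (1 - a / (a + t)) = a * t / (a + t) by field_simp; ring,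
    le_div_iff₀ hat]
  nlinarith

/-- If every logarithmic growth rate `E log (1 + (r - 1) / (n + 2))` is nonpositive,
then `r` has expectation at most one. -/
theorem integrable_and_integral_le_one_of_integral_log_nonpos
    {X : Type*} [MeasurableSpace X] {P : Measure X} [IsProbabilityMeasure P]
    {r : X → ℝ} (hr : Measurable r) (hr0 : ∀ᵐ x ∂P, 0 ≤ r x)
    (hint : ∀ n : ℕ, Integrable (fun x => Real.log (1 + (r x - 1) / ((n : ℝ) + 2))) P)
    (hle : ∀ n : ℕ, ∫ x, Real.log (1 + (r x - 1) / ((n : ℝ) + 2)) ∂P ≤ 0) :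
    Integrable r P ∧ ∫ x, r x ∂P ≤ 1 := by
  let f : ℕ → X → ℝ := fun n x =>
    ((n : ℝ) + 2) * Real.log (1 + (r x - 1) / ((n : ℝ) + 2)) + 2
  have hf_meas : ∀ n, Measurable (f n) := fun n => by fun_prop
  have hf_int : ∀ n, Integrable (f n) P := fun n =>
    ((hint n).const_mul _).add (integrable_const _)
  have hf_nonneg : ∀ n, 0 ≤ᵐ[P] f n := fun n => by
    filter_upwards [hr0] with x hx
    have := neg_two_le_mul_log_one_add_div (t := r x - 1) (by linarith)
      (a := (n : ℝ) + 2) (by linarith [n.cast_nonneg (α := ℝ)])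
    simp only [f, Pi.zero_apply]
    linarith
  have hf_le : ∀ n, ∫⁻ x, ENNReal.ofReal (f n x) ∂P ≤ ENNReal.ofReal 2 := fun n => by
    rw [← ofReal_integral_eq_lintegral_ofReal (hf_int n) (hf_nonneg n)]
    refine ENNReal.ofReal_le_ofReal ?_
    have heq : ∫ x, f n x ∂P =
        ((n : ℝ) + 2) * ∫ x, Real.log (1 + (r x - 1) / ((n : ℝ) + 2)) ∂P + 2 := by
      simp only [f]
      rw [integral_add ((hint n).const_mul _) (integrable_const _), integral_const_mul]
      simp
    rw [heq]
    have := mul_nonpos_of_nonneg_of_nonpos (by positivity : 0 ≤ (n : ℝ) + 2) (hle n)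
    linarith
  have hlim : ∀ x, Tendsto (fun n => ENNReal.ofReal (f n x)) atTop
      (nhds (ENNReal.ofReal (r x + 1))) := fun x => by
    refine ENNReal.tendsto_ofReal ?_
    have hcast : Tendsto (fun n : ℕ => (n : ℝ) + 2) atTop atTop :=
      tendsto_atTop_add_const_right _ _ tendsto_natCast_atTop_atTop
    have h := ((Real.tendsto_mul_log_one_add_div_atTop (r x - 1)).comp hcast).add_const 2
    rw [show r x - 1 + 2 = r x + 1 by ring] at h
    exact h
  have hfatou : ∫⁻ x, ENNReal.ofReal (r x + 1) ∂P ≤ ENNReal.ofReal 2 := by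
    calc ∫⁻ x, ENNReal.ofReal (r x + 1) ∂P
        = ∫⁻ x, liminf (fun n => ENNReal.ofReal (f n x)) atTop ∂P := by
          simp_rw [fun x => (hlim x).liminf_eq]
      _ ≤ liminf (fun n => ∫⁻ x, ENNReal.ofReal (f n x) ∂P) atTop :=
          lintegral_liminf_le fun n => (hf_meas n).ennreal_ofReal
      _ ≤ liminf (fun _ : ℕ => ENNReal.ofReal 2) atTop :=
          liminf_le_liminf (Eventually.of_forall hf_le)
      _ = ENNReal.ofReal 2 := liminf_const _
  have hnonneg : 0 ≤ᵐ[P] fun x => r x + 1 := by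
    filter_upwards [hr0] with x hx
    simp only [Pi.zero_apply]
    linarith
  have hint1 : Integrable (fun x => r x + 1) P :=
    (lintegral_ofReal_ne_top_iff_integrable (by fun_prop) hnonneg).1
      (hfatou.trans_lt ENNReal.ofReal_lt_top).ne
  have hr_int : Integrable r P := by
    refine (hint1.sub (integrable_const (1 : ℝ))).congr (Eventually.of_forall fun x => ?_)
    simp
  refine ⟨hr_int, ?_⟩
  rw [← ofReal_integral_eq_lintegral_ofReal hint1 hnonneg,
    ENNReal.ofReal_le_ofReal_iff (by norm_num),
    integral_add hr_int (integrable_const _)] at hfatou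
  simp at hfatou
  linarith

/-- Equality case of `E (r ^ α) ≤ 1` for a nonnegative `r` with `E r ≤ 1`. -/
theorem ae_eq_one_of_integral_rpow_eq_one
    {X : Type*} [MeasurableSpace X] {P : Measure X} [IsProbabilityMeasure P]
    {r : X → ℝ} (hr0 : ∀ᵐ x ∂P, 0 ≤ r x) (hr : Integrable r P) (hle : ∫ x, r x ∂P ≤ 1)
    {α : ℝ} (hα0 : 0 < α) (hα1 : α < 1) (hint : Integrable (fun x => r x ^ α) P)
    (heq : ∫ x, r x ^ α ∂P = 1) : ∀ᵐ x ∂P, r x = 1 := by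
  let g : X → ℝ := fun x => 1 - α + α * r x
  have hg : Integrable g P := (integrable_const _).add (hr.const_mul _)
  have hgap_nonneg : 0 ≤ᵐ[P] fun x => g x - r x ^ α := by
    filter_upwards [hr0] with x hx
    have := rpow_one_add_le_one_add_mul_self (s := r x - 1) (by linarith) hα0.le hα1.le
    rw [add_sub_cancel] at this
    simp only [g, Pi.zero_apply]
    linarith
  have hgap_integral : ∫ x, (g x - r x ^ α) ∂P = 0 := by
    refine le_antisymm ?_ (integral_nonneg_of_ae hgap_nonneg)
    have hg_eq : ∫ x, g x ∂P = 1 - α + α * ∫ x, r x ∂P := by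
      simp only [g]
      rw [integral_add (integrable_const _) (hr.const_mul _), integral_const_mul]
      simp
    rw [integral_sub hg hint, heq, hg_eq]
    nlinarith
  have hgap := (integral_eq_zero_iff_of_nonneg_ae hgap_nonneg (hg.sub hint)).1 hgap_integral
  filter_upwards [hr0, hgap] with x hx hgx
  by_contra hne
  have := rpow_one_add_lt_one_add_mul_self (s := r x - 1) (by linarith)
    (sub_ne_zero.2 hne) hα0 hα1
  rw [add_sub_cancel] at this
  simp only [g, Pi.zero_apply] at hgx
  linarith

theorem integrable_rpow_of_integrable
    {X : Type*} [MeasurableSpace X] {P : Measure X} [IsFiniteMeasure P]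
    {r : X → ℝ} (hr0 : ∀ᵐ x ∂P, 0 ≤ r x) (hr : Integrable r P)
    {α : ℝ} (hα0 : 0 ≤ α) (hα1 : α ≤ 1) : Integrable (fun x => r x ^ α) P := by
  refine ((integrable_const (1 - α)).add (hr.const_mul α)).mono'
    (hr.aemeasurable.pow_const α).aestronglyMeasurable ?_
  filter_upwards [hr0] with x hx
  have := rpow_one_add_le_one_add_mul_self (s := r x - 1) (by linarith) hα0 hα1
  rw [add_sub_cancel] at this
  rw [Real.norm_of_nonneg (Real.rpow_nonneg hx α)]
  simp only [Pi.add_apply]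
  linarith

theorem integrable_withDensity_ofReal_iff {X : Type*} [MeasurableSpace X] {μ : Measure X}
    {q : X → ℝ} (hq : Measurable q) (hq0 : ∀ x, 0 ≤ q x) {g : X → ℝ} :
    Integrable g (μ.withDensity fun x => ENNReal.ofReal (q x)) ↔
      Integrable (fun x => q x * g x) μ := by
  rw [integrable_withDensity_iff_integrable_smul' hq.ennreal_ofReal
    (Eventually.of_forall fun _ => ENNReal.ofReal_lt_top)]
  simp only [ENNReal.toReal_ofReal (hq0 _), smul_eq_mul]

theorem integral_withDensity_ofReal {X : Type*} [MeasurableSpace X] {μ : Measure X}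
    {q : X → ℝ} (hq : Measurable q) (hq0 : ∀ x, 0 ≤ q x) (g : X → ℝ) :
    ∫ x, g x ∂(μ.withDensity fun x => ENNReal.ofReal (q x)) = ∫ x, q x * g x ∂μ := by
  rw [integral_withDensity_eq_integral_toReal_smul hq.ennreal_ofReal
    (Eventually.of_forall fun _ => ENNReal.ofReal_lt_top)]
  simp only [ENNReal.toReal_ofReal (hq0 _), smul_eq_mul]

theorem isProbabilityMeasure_withDensity_ofReal {X : Type*} [MeasurableSpace X]
    {μ : Measure X} {q : X → ℝ} (hq0 : ∀ x, 0 ≤ q x) (hq1 : ∫ x, q x ∂μ = 1) :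
    IsProbabilityMeasure (μ.withDensity fun x => ENNReal.ofReal (q x)) := by
  have hint : Integrable q μ := by
    by_contra h
    simp [integral_undef h] at hq1
  refine ⟨?_⟩
  rw [withDensity_apply _ MeasurableSet.univ, Measure.restrict_univ,
    ← ofReal_integral_eq_lintegral_ofReal hint (Eventually.of_forall hq0), hq1,
    ENNReal.ofReal_one]

/-- Strict positivity of the α-divergence off the optimum: under the hypotheses of
Lemma 3.1, `D_{θ0,α}(θ, θ*) = 0` iff `p_θ = p_{θ*}` almost everywhere on the support
of `P_{θ0}`. -/
theorem alpha_divergence_eq_zero_iff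
    {X Θ : Type*} [MeasurableSpace X]
    (μ : Measure X) [SigmaFinite μ]
    (p : Θ → X → ℝ) (p0 : X → ℝ)
    (hp_meas : ∀ θ, Measurable (p θ)) (hp0_meas : Measurable p0)
    (hp_nonneg : ∀ θ x, 0 ≤ p θ x) (hp0_nonneg : ∀ x, 0 ≤ p0 x)
    (hp_dens : ∀ θ, ∫ x, p θ x ∂μ = 1) (hp0_dens : ∫ x, p0 x ∂μ = 1)
    (hp_pos : ∀ θ : Θ,
      ∀ᵐ x ∂(μ.withDensity fun x => ENNReal.ofReal (p0 x)), 0 < p θ x)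
    (hconvex : ∀ θ θ' : Θ, ∀ ω : ℝ, 0 < ω → ω < 1 →
      ∃ θbar : Θ, ∀ᵐ x ∂μ, p θbar x = ω * p θ x + (1 - ω) * p θ' x)
    (hKL_int : ∀ θ : Θ, Integrable (fun x => p0 x * Real.log (p0 x / p θ x)) μ)
    (θstar : Θ) (hθstar : ∀ θ : Θ, klDivFn μ p0 (p θstar) ≤ klDivFn μ p0 (p θ))
    (α : ℝ) (hα0 : 0 < α) (hα1 : α < 1) (θ : Θ) :
    alphaDiv μ p p0 α θ θstar = 0 ↔
      (∀ᵐ x ∂(μ.withDensity fun x => ENNReal.ofReal (p0 x)), p θ x = p θstar x) := by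
  let P : Measure X := μ.withDensity fun x => ENNReal.ofReal (p0 x)
  have hP : IsProbabilityMeasure P :=
    isProbabilityMeasure_withDensity_ofReal hp0_nonneg hp0_dens
  have hp0_pos : ∀ᵐ x ∂P, 0 < p0 x := by
    rw [ae_withDensity_iff hp0_meas.ennreal_ofReal]
    exact Eventually.of_forall fun x hx => by simpa using hx
  let r : X → ℝ := fun x => p θ x / p θstar x
  have hr_meas : Measurable r := (hp_meas θ).div (hp_meas θstar)
  have hr_pos : ∀ᵐ x ∂P, 0 < r x := by
    filter_upwards [hp_pos θ, hp_pos θstar] with x h1 h2 using div_pos h1 h2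
  have hr_nonneg : ∀ᵐ x ∂P, 0 ≤ r x := hr_pos.mono fun _ => le_of_lt
  have hL_int : ∀ θ', Integrable (fun x => Real.log (p0 x / p θ' x)) P := fun θ' =>
    (integrable_withDensity_ofReal_iff hp0_meas hp0_nonneg).2 (hKL_int θ')
  have hL_le : ∀ θ', ∫ x, Real.log (p0 x / p θstar x) ∂P ≤
      ∫ x, Real.log (p0 x / p θ' x) ∂P := fun θ' => by
    simpa only [P, integral_withDensity_ofReal hp0_meas hp0_nonneg, klDivFn] using hθstar θ'
  have hmix : ∀ n : ℕ, ∃ θ' : Θ,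
      (fun x => Real.log (p0 x / p θstar x) - Real.log (p0 x / p θ' x)) =ᵐ[P]
        fun x => Real.log (1 + (r x - 1) / ((n : ℝ) + 2)) := fun n => by
    have hn : (1 : ℝ) < (n : ℝ) + 2 := by linarith [n.cast_nonneg (α := ℝ)]
    obtain ⟨θ', hθ'⟩ := hconvex θ θstar ((n : ℝ) + 2)⁻¹ (by positivity) (inv_lt_one_of_one_lt₀ hn)
    refine ⟨θ', ?_⟩
    filter_upwards [hp0_pos, hp_pos θstar, hp_pos θ',
      (withDensity_absolutelyContinuous μ _).ae_le hθ'] with x h0 hs h' hx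
    rw [Real.log_div h0.ne' hs.ne', Real.log_div h0.ne' h'.ne', sub_sub_sub_cancel_left,
      ← Real.log_div h'.ne' hs.ne', hx]
    congr 1
    simp only [r]
    field_simp
    ring
  obtain ⟨hr_int, hr_le⟩ := integrable_and_integral_le_one_of_integral_log_nonpos hr_meas
    hr_nonneg
    (fun n => by
      obtain ⟨θ', h⟩ := hmix n
      exact ((hL_int θstar).sub (hL_int θ')).congr h)
    (fun n => by
      obtain ⟨θ', h⟩ := hmix n
      rw [← integral_congr_ae h, integral_sub (hL_int θstar) (hL_int θ')]
      exact sub_nonpos.2 (hL_le θ'))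
  have hrα_int : Integrable (fun x => r x ^ α) P :=
    integrable_rpow_of_integrable hr_nonneg hr_int hα0.le hα1.le
  have hrα_pos : ∀ᵐ x ∂P, 0 < r x ^ α := hr_pos.mono fun x hx => Real.rpow_pos_of_pos hx α
  have haff : alphaAff μ p p0 α θ θstar = ∫ x, r x ^ α ∂P := by
    simp only [alphaAff, P, r, integral_withDensity_ofReal hp0_meas hp0_nonneg, mul_comm]
  have haff_pos : 0 < ∫ x, r x ^ α ∂P := by
    refine (integral_nonneg_of_ae (hrα_pos.mono fun _ => le_of_lt)).lt_of_ne' fun h => ?_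
    have hzero := (integral_eq_zero_iff_of_nonneg_ae
      (hrα_pos.mono fun _ => le_of_lt) hrα_int).1 h
    obtain ⟨x, hx, hx'⟩ := (hrα_pos.and hzero).exists
    exact hx.ne' hx'
  have hdiv : alphaDiv μ p p0 α θ θstar = 0 ↔ ∫ x, r x ^ α ∂P = 1 := by
    rw [alphaDiv, haff, mul_eq_zero_iff_left (inv_ne_zero (sub_ne_zero.2 hα1.ne))]
    exact ⟨Real.eq_one_of_pos_of_log_eq_zero haff_pos, fun h => by rw [h, Real.log_one]⟩
  rw [hdiv]
  constructor
  · intro h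
    filter_upwards [hp_pos θstar,
      ae_eq_one_of_integral_rpow_eq_one hr_nonneg hr_int hr_le hα0 hα1 hrα_int h] with x hs hx
    exact (div_eq_one_iff_eq hs.ne').1 hx
  · intro h
    have hone : (fun x => r x ^ α) =ᵐ[P] fun _ => (1 : ℝ) := by
      filter_upwards [h, hp_pos θstar] with x hx hs
      simp only [r, hx, div_self hs.ne', Real.one_rpow]
    rw [integral_congr_ae hone]
    simp
end
end
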